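/- arXiv:2605.26593 — 2 statements merged into one kernel-verified Lean document; each statement's English description precedes it below -/
import Mathlib

section
/- The set 𝒜 is a closed *-subalgebra of the C*-algebra of bounded complex-valued functions on ℝ² with the supremum norm: 𝒜 is closed under addition, scalar multiplication, pointwise multiplication and complex conjugation, and if f_n ∈ 𝒜 converge uniformly on ℝ² to a bounded function f that is 2π-periodic in each variable, then f ∈ 𝒜. -/
open Filter Topology

noncomputable section

/-- The set `E ⊂ ℝ` of reals congruent to an integer modulo `2π`. -/
def ESet : Set ℝ := {x | ∃ k m : ℤ, x = (k : ℝ) + 2 * Real.pi * (m : ℝ)}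

/-- The set `E_N ⊂ ℝ` of reals congruent to an integer `k` with `|k| ≤ N` modulo `2π`. -/
def ESetN (N : ℕ) : Set ℝ :=
  {x | ∃ k m : ℤ, |k| ≤ (N : ℤ) ∧ x = (k : ℝ) + 2 * Real.pi * (m : ℝ)}

/-- The function `f : ℝ² → ℂ` is bounded. -/
def Bdd (f : ℝ × ℝ → ℂ) : Prop := ∃ C : ℝ, ∀ p, ‖f p‖ ≤ C

/-- The function `f : ℝ² → ℂ` is `2π`-periodic in each variable. -/
def Per (f : ℝ × ℝ → ℂ) : Prop :=
  ∀ x y : ℝ, f (x + 2 * Real.pi, y) = f (x, y) ∧ f (x, y + 2 * Real.pi) = f (x, y)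

/-- A bounded continuous `2π`-periodic function of one variable. -/
def NicePer (g : ℝ → ℂ) : Prop :=
  (∃ C : ℝ, ∀ x, ‖g x‖ ≤ C) ∧ Continuous g ∧ ∀ x, g (x + 2 * Real.pi) = g x

/-- `gp` and `gm` are the one-sided limits of `f` from above and from below along the
horizontal line at height `e`, and `f` is right-continuous there:
`f(y₁,t) → gp(x₁)` as `(y₁,t) → (x₁,e)`, `t > e`; `f(y₁,t) → gm(x₁)` as `(y₁,t) → (x₁,e)`,
`t < e`; and `f(x₁,e) = gp(x₁)`. -/
def SidedLimits (f : ℝ × ℝ → ℂ) (e : ℝ) (gp gm : ℝ → ℂ) : Prop :=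
  NicePer gp ∧ NicePer gm ∧
  ∀ x₁ : ℝ,
    Tendsto f (𝓝[{p : ℝ × ℝ | e < p.2}] (x₁, e)) (𝓝 (gp x₁)) ∧
    Tendsto f (𝓝[{p : ℝ × ℝ | p.2 < e}] (x₁, e)) (𝓝 (gm x₁)) ∧
    f (x₁, e) = gp x₁

/-- Membership in the algebra `𝒜`: `f` is bounded, `2π`-periodic in each variable,
continuous at every point `(x₁,x₂)` with `x₂ ∉ E`, has one-sided limit functions
`f_e⁺ = gp e`, `f_e⁻ = gm e` (with right continuity) at every `e ∈ E`, and
`sup_{x₁} |f_k⁺(x₁) − f_k⁻(x₁)| → 0` as `|k| → ∞`, `k ∈ ℤ`. -/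
def MemA (f : ℝ × ℝ → ℂ) : Prop :=
  Bdd f ∧ Per f ∧
  (∀ p : ℝ × ℝ, p.2 ∉ ESet → ContinuousAt f p) ∧
  ∃ gp gm : ℝ → ℝ → ℂ,
    (∀ e ∈ ESet, SidedLimits f e (gp e) (gm e)) ∧
    Tendsto (fun k : ℤ => ⨆ x : ℝ, ‖gp (k : ℝ) x - gm (k : ℝ) x‖) cofinite (𝓝 0)

/-- Membership in `𝒞_N`: `f` is bounded, `2π`-periodic in each variable, continuous at
every point `(x₁,x₂)` with `x₂ ∉ E_N`, and has one-sided limit functions (with right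
continuity) at every `e ∈ E_N`. -/
def MemC (N : ℕ) (f : ℝ × ℝ → ℂ) : Prop :=
  Bdd f ∧ Per f ∧
  (∀ p : ℝ × ℝ, p.2 ∉ ESetN N → ContinuousAt f p) ∧
  ∀ e ∈ ESetN N, ∃ gp gm : ℝ → ℂ, SidedLimits f e gp gm

lemma neBot_nhdsWithin_below (x e : ℝ) : (𝓝[{p : ℝ × ℝ | p.2 < e}] (x, e)).NeBot := by
  have h : {p : ℝ × ℝ | p.2 < e} = Set.univ ×ˢ Set.Iio e := by
    ext p
    simp
  rw [h, nhdsWithin_prod_eq, nhdsWithin_univ]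
  infer_instance

lemma intCast_mem_ESet (k : ℤ) : (k : ℝ) ∈ ESet := ⟨k, 0, by simp⟩

/-- The supremum of the jumps tends to zero as soon as the jumps do so uniformly. -/
lemma tendsto_iSup_norm_sub_zero {u v : ℤ → ℝ → ℂ}
    (h : ∀ ε > 0, ∀ᶠ k in cofinite, ∀ x, ‖u k x - v k x‖ ≤ ε) :
    Tendsto (fun k : ℤ => ⨆ x : ℝ, ‖u k x - v k x‖) cofinite (𝓝 0) := by
  rw [Metric.tendsto_nhds]
  intro ε hε
  filter_upwards [h (ε / 2) (by positivity)] with k hk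
  have h0 : 0 ≤ ⨆ x : ℝ, ‖u k x - v k x‖ := Real.iSup_nonneg fun x => norm_nonneg _
  have h1 : ⨆ x : ℝ, ‖u k x - v k x‖ ≤ ε / 2 := ciSup_le hk
  rw [Real.dist_eq, sub_zero, abs_of_nonneg h0]
  linarith

lemma eventually_forall_norm_sub_lt {u v : ℤ → ℝ → ℂ} (hu : ∀ k, NicePer (u k))
    (hv : ∀ k, NicePer (v k))
    (h : Tendsto (fun k : ℤ => ⨆ x : ℝ, ‖u k x - v k x‖) cofinite (𝓝 0)) {ε : ℝ} (hε : 0 < ε) :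
    ∀ᶠ k in cofinite, ∀ x, ‖u k x - v k x‖ < ε := by
  filter_upwards [h.eventually_lt_const hε] with k hk x
  obtain ⟨C, hC⟩ := (hu k).1
  obtain ⟨D, hD⟩ := (hv k).1
  have hb : BddAbove (Set.range fun x : ℝ => ‖u k x - v k x‖) := by
    refine ⟨C + D, ?_⟩
    rintro _ ⟨y, rfl⟩
    exact (norm_sub_le _ _).trans (add_le_add (hC y) (hD y))
  exact (le_ciSup hb x).trans_lt hk

lemma SidedLimits.norm_above_le {f : ℝ × ℝ → ℂ} {e C : ℝ} {gp gm : ℝ → ℂ}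
    (h : SidedLimits f e gp gm) (hC : ∀ p, ‖f p‖ ≤ C) (x : ℝ) : ‖gp x‖ ≤ C :=
  (h.2.2 x).2.2 ▸ hC _

lemma SidedLimits.norm_below_le {f : ℝ × ℝ → ℂ} {e C : ℝ} {gp gm : ℝ → ℂ}
    (h : SidedLimits f e gp gm) (hC : ∀ p, ‖f p‖ ≤ C) (x : ℝ) : ‖gm x‖ ≤ C :=
  have := neBot_nhdsWithin_below x e
  le_of_tendsto (h.2.2 x).2.1.norm (Eventually.of_forall hC)

lemma SidedLimits.dist_below_le {f g : ℝ × ℝ → ℂ} {e C : ℝ} {fp fm gp gm : ℝ → ℂ}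
    (hf : SidedLimits f e fp fm) (hg : SidedLimits g e gp gm) (hC : ∀ p, dist (f p) (g p) ≤ C)
    (x : ℝ) : dist (fm x) (gm x) ≤ C :=
  have := neBot_nhdsWithin_below x e
  le_of_tendsto ((hf.2.2 x).2.1.dist (hg.2.2 x).2.1) (Eventually.of_forall hC)

lemma exists_norm_comp_le {φ : ℂ × ℂ → ℂ} (hφ : Continuous φ) (C D : ℝ) :
    ∃ M, ∀ z w, ‖z‖ ≤ C → ‖w‖ ≤ D → ‖φ (z, w)‖ ≤ M := by
  obtain ⟨M, hM⟩ := ((isCompact_closedBall (0 : ℂ) C).prod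
    (isCompact_closedBall (0 : ℂ) D)).exists_bound_of_continuousOn hφ.continuousOn
  exact ⟨M, fun z w hz hw => hM (z, w) ⟨by simpa using hz, by simpa using hw⟩⟩

lemma NicePer.comp₂ {φ : ℂ × ℂ → ℂ} (hφ : Continuous φ) {u v : ℝ → ℂ} (hu : NicePer u)
    (hv : NicePer v) : NicePer fun x => φ (u x, v x) := by
  obtain ⟨⟨C, hC⟩, huc, hup⟩ := hu
  obtain ⟨⟨D, hD⟩, hvc, hvp⟩ := hv
  obtain ⟨M, hM⟩ := exists_norm_comp_le hφ C D
  exact ⟨⟨M, fun x => hM _ _ (hC x) (hD x)⟩, hφ.comp (huc.prodMk hvc),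
    fun x => by simp only [hup, hvp]⟩

lemma SidedLimits.comp₂ {φ : ℂ × ℂ → ℂ} (hφ : Continuous φ) {f g : ℝ × ℝ → ℂ} {e : ℝ}
    {fp fm gp gm : ℝ → ℂ} (hf : SidedLimits f e fp fm) (hg : SidedLimits g e gp gm) :
    SidedLimits (fun p => φ (f p, g p)) e (fun x => φ (fp x, gp x))
      (fun x => φ (fm x, gm x)) := by
  refine ⟨hf.1.comp₂ hφ hg.1, hf.2.1.comp₂ hφ hg.2.1, fun x => ?_⟩
  obtain ⟨hf₁, hf₂, hf₃⟩ := hf.2.2 x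
  obtain ⟨hg₁, hg₂, hg₃⟩ := hg.2.2 x
  exact ⟨(hφ.tendsto _).comp (hf₁.prodMk_nhds hg₁), (hφ.tendsto _).comp (hf₂.prodMk_nhds hg₂),
    by simp only [hf₃, hg₃]⟩

/-- `𝒜` is closed under applying a continuous function of two complex variables. -/
lemma MemA.comp₂ {φ : ℂ × ℂ → ℂ} (hφ : Continuous φ) {f g : ℝ × ℝ → ℂ} (hf : MemA f)
    (hg : MemA g) : MemA fun p => φ (f p, g p) := by
  obtain ⟨⟨C, hC⟩, hfp, hfc, fp, fm, hfs, hfj⟩ := hf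
  obtain ⟨⟨D, hD⟩, hgp, hgc, gp, gm, hgs, hgj⟩ := hg
  obtain ⟨M, hM⟩ := exists_norm_comp_le hφ C D
  refine ⟨⟨M, fun p => hM _ _ (hC p) (hD p)⟩,
    fun x y => ⟨by simp only [(hfp x y).1, (hgp x y).1], by simp only [(hfp x y).2, (hgp x y).2]⟩,
    fun p hp => hφ.continuousAt.comp ((hfc p hp).prodMk (hgc p hp)),
    fun e x => φ (fp e x, gp e x), fun e x => φ (fm e x, gm e x),
    fun e he => (hfs e he).comp₂ hφ (hgs e he),
    tendsto_iSup_norm_sub_zero (u := fun k x => φ (fp k x, gp k x))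
      (v := fun k x => φ (fm k x, gm k x)) fun ε hε => ?_⟩
  have huc := ((isCompact_closedBall (0 : ℂ) C).prod
    (isCompact_closedBall (0 : ℂ) D)).uniformContinuousOn_of_continuous hφ.continuousOn
  obtain ⟨δ, hδ, hφδ⟩ := Metric.uniformContinuousOn_iff.1 huc ε hε
  have hfs' := fun k : ℤ => hfs k (intCast_mem_ESet k)
  have hgs' := fun k : ℤ => hgs k (intCast_mem_ESet k)
  filter_upwards [eventually_forall_norm_sub_lt (fun k => (hfs' k).1) (fun k => (hfs' k).2.1) hfj hδ,
    eventually_forall_norm_sub_lt (fun k => (hgs' k).1) (fun k => (hgs' k).2.1) hgj hδ] with k hk₁ hk₂ x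
  rw [← dist_eq_norm]
  refine (hφδ (fp k x, gp k x) ⟨?_, ?_⟩ (fm k x, gm k x) ⟨?_, ?_⟩ ?_).le
  · simpa using (hfs' k).norm_above_le hC x
  · simpa using (hgs' k).norm_above_le hD x
  · simpa using (hfs' k).norm_below_le hC x
  · simpa using (hgs' k).norm_below_le hD x
  · rw [Prod.dist_eq, max_lt_iff, dist_eq_norm, dist_eq_norm]
    exact ⟨hk₁ x, hk₂ x⟩

lemma nicePer_of_tendstoUniformly {G : ℕ → ℝ → ℂ} {g : ℝ → ℂ} {C : ℝ} (hG : ∀ n, NicePer (G n))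
    (h : TendstoUniformly G g atTop) (hC : ∀ x, ‖g x‖ ≤ C) : NicePer g := by
  refine ⟨⟨C, hC⟩, h.continuous (Frequently.of_forall fun n => (hG n).2.1), fun x => ?_⟩
  refine tendsto_nhds_unique (h.tendsto_at (x + 2 * Real.pi)) ?_
  simpa only [(hG _).2.2 x] using h.tendsto_at x

/-- `𝒜` is closed under uniform limits. -/
lemma MemA.of_tendstoUniformly {F : ℕ → ℝ × ℝ → ℂ} {f : ℝ × ℝ → ℂ} (hF : ∀ n, MemA (F n))
    (h : TendstoUniformly F f atTop) (hb : Bdd f) (hper : Per f) : MemA f := by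
  choose _ _ hFc gp gm hs hj using hF
  have hgp : ∀ n, ∀ e ∈ ESet, ∀ x, F n (x, e) = gp n e x :=
    fun n e he x => ((hs n e he).2.2 x).2.2
  have hcauchy : UniformCauchySeqOn (fun n (q : ℝ × ℝ) => gm n q.1 q.2) atTop
      (ESet ×ˢ Set.univ) := by
    rw [Metric.uniformCauchySeqOn_iff]
    intro ε hε
    obtain ⟨N, hN⟩ := Metric.uniformCauchySeqOn_iff.1
      (tendstoUniformlyOn_univ.2 h).uniformCauchySeqOn (ε / 2) (by positivity)
    refine ⟨N, fun m hm n hn q hq => ?_⟩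
    have := (hs m q.1 hq.1).dist_below_le (hs n q.1 hq.1)
      (fun p => (hN m hm n hn p (Set.mem_univ _)).le) q.2
    linarith
  have hlim : ∀ q : ℝ × ℝ, ∃ z, q ∈ ESet ×ˢ (Set.univ : Set ℝ) →
      Tendsto (fun n => gm n q.1 q.2) atTop (𝓝 z) := by
    intro q
    by_cases hq : q ∈ ESet ×ˢ (Set.univ : Set ℝ)
    · obtain ⟨z, hz⟩ := cauchySeq_tendsto_of_complete (hcauchy.cauchySeq hq)
      exact ⟨z, fun _ => hz⟩
    · exact ⟨0, fun h => absurd h hq⟩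
  choose L hL using hlim
  have hunif := hcauchy.tendstoUniformlyOn_of_tendsto fun q hq => hL q hq
  have hunif_below : ∀ e ∈ ESet,
      TendstoUniformly (fun n => gm n e) (fun x => L (e, x)) atTop := by
    intro e he
    rw [Metric.tendstoUniformly_iff]
    intro ε hε
    filter_upwards [Metric.tendstoUniformlyOn_iff.1 hunif ε hε] with n hn x
    exact hn (e, x) ⟨he, Set.mem_univ _⟩
  have hunif_above : ∀ e ∈ ESet,
      TendstoUniformly (fun n => gp n e) (fun x => f (x, e)) atTop := by
    intro e he
    have hgp_eq : (fun n => gp n e) = fun n x => F n (x, e) :=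
      funext₂ fun n x => (hgp n e he x).symm
    rw [hgp_eq]
    exact TendstoUniformly.comp h fun x => (x, e)
  have hfilter : ∀ l : Filter (ℝ × ℝ), TendstoUniformlyOnFilter F f atTop l := fun l =>
    (tendstoUniformly_iff_tendstoUniformlyOnFilter.1 h).mono_right le_top
  have hbelow : ∀ e ∈ ESet, ∀ x,
      Tendsto f (𝓝[{p : ℝ × ℝ | p.2 < e}] (x, e)) (𝓝 (L (e, x))) := fun e he x =>
    (hfilter _).tendsto_of_eventually_tendsto
      (Eventually.of_forall fun n => ((hs n e he).2.2 x).2.1) ((hunif_below e he).tendsto_at x)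
  have habove : ∀ e ∈ ESet, ∀ x,
      Tendsto f (𝓝[{p : ℝ × ℝ | e < p.2}] (x, e)) (𝓝 (f (x, e))) := fun e he x =>
    (hfilter _).tendsto_of_eventually_tendsto
      (Eventually.of_forall fun n => ((hs n e he).2.2 x).1) ((hunif_above e he).tendsto_at x)
  have hcont : ∀ p : ℝ × ℝ, p.2 ∉ ESet → ContinuousAt f p := fun p hp =>
    (hfilter _).tendsto_of_eventually_tendsto
      (Eventually.of_forall fun n => hFc n p hp) (h.tendsto_at p)
  have ⟨C, hC⟩ := hb
  refine ⟨hb, hper, hcont, fun e x => f (x, e), fun e x => L (e, x), fun e he => ⟨?_, ?_, ?_⟩,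
    tendsto_iSup_norm_sub_zero (u := fun k x => f (x, k)) (v := fun k x => L (k, x))
      fun ε hε => ?_⟩
  · exact nicePer_of_tendstoUniformly (fun n => (hs n e he).1) (hunif_above e he) fun x => hC _
  · refine nicePer_of_tendstoUniformly (C := C) (fun n => (hs n e he).2.1) (hunif_below e he)
      fun x => ?_
    have := neBot_nhdsWithin_below x e
    exact le_of_tendsto (hbelow e he x).norm (Eventually.of_forall hC)
  · exact fun x => ⟨habove e he x, hbelow e he x, rfl⟩
  · obtain ⟨n, hn₁, hn₂⟩ := ((Metric.tendstoUniformly_iff.1 h (ε / 3) (by positivity)).and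
      (Metric.tendstoUniformlyOn_iff.1 hunif (ε / 3) (by positivity))).exists
    have hsk := fun k : ℤ => hs n k (intCast_mem_ESet k)
    filter_upwards [eventually_forall_norm_sub_lt (fun k => (hsk k).1) (fun k => (hsk k).2.1) (hj n)
      (by positivity : 0 < ε / 3)] with k hk x
    have h₁ := hn₁ (x, k)
    have h₂ := hn₂ (k, x) ⟨intCast_mem_ESet k, Set.mem_univ _⟩
    have h₃ := hk x
    rw [hgp n k (intCast_mem_ESet k)] at h₁
    rw [dist_comm] at h₂
    rw [← dist_eq_norm] at h₃ ⊢
    linarith [dist_triangle4 (f (x, k)) (gp n k x) (gm n k x) (L (k, x))]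

/-- `𝒜` is a closed *-subalgebra of the bounded functions on `ℝ²` with the sup norm:
closed under addition, scalar multiplication, pointwise multiplication, complex
conjugation, and uniform limits (of bounded `2π`-periodic limit functions). -/
theorem stmt_0 :
    (∀ f g : ℝ × ℝ → ℂ, MemA f → MemA g → MemA (fun p => f p + g p)) ∧
    (∀ (c : ℂ) (f : ℝ × ℝ → ℂ), MemA f → MemA (fun p => c * f p)) ∧
    (∀ f g : ℝ × ℝ → ℂ, MemA f → MemA g → MemA (fun p => f p * g p)) ∧
    (∀ f : ℝ × ℝ → ℂ, MemA f → MemA (fun p => starRingEnd ℂ (f p))) ∧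
    (∀ (F : ℕ → ℝ × ℝ → ℂ) (f : ℝ × ℝ → ℂ), (∀ n, MemA (F n)) →
      TendstoUniformly F f atTop → Bdd f → Per f → MemA f) := by
  refine ⟨fun f g hf hg => ?_, fun c f hf => ?_, fun f g hf hg => ?_, fun f hf => ?_,
    fun F f hF h hb hper => MemA.of_tendstoUniformly hF h hb hper⟩
  · exact hf.comp₂ (φ := fun z => z.1 + z.2) (by fun_prop) hg
  · exact hf.comp₂ (φ := fun z => c * z.1) (by fun_prop) hf
  · exact hf.comp₂ (φ := fun z => z.1 * z.2) (by fun_prop) hg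
  · exact hf.comp₂ (φ := fun z => starRingEnd ℂ z.1)
      (Complex.continuous_conj.comp continuous_fst) hf
end
end

section
/- For every f ∈ 𝒜 and every ε > 0 there exist a natural number N and a function g ∈ 𝒞_N such that sup_{(x₁,x₂)∈ℝ²} |f(x₁,x₂) − g(x₁,x₂)| ≤ ε. In other words, the union ⋃_N 𝒞_N is dense in 𝒜 with respect to the supremum norm. -/
open Filter Topology

noncomputable section

open MeasureTheory

lemma add_two_pi_mul_mem_ESetN {N : ℕ} {t : ℝ} (m : ℤ) :
    t + 2 * Real.pi * m ∈ ESetN N ↔ t ∈ ESetN N := by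
  constructor
  · rintro ⟨k, n, hk, h⟩
    exact ⟨k, n - m, hk, by push_cast; linarith⟩
  · rintro ⟨k, n, hk, h⟩
    exact ⟨k, n + m, hk, by push_cast; linarith⟩

lemma ESetN_subset_ESet (N : ℕ) : ESetN N ⊆ ESet := fun _ ⟨k, m, _, h⟩ => ⟨k, m, h⟩

lemma countable_ESet : ESet.Countable := by
  have : ESet = Set.range fun q : ℤ × ℤ => (q.1 : ℝ) + 2 * Real.pi * (q.2 : ℝ) := by
    ext x
    simp [ESet, eq_comm]
  rw [this]
  exact Set.countable_range _

lemma Per.add_int_mul {f : ℝ × ℝ → ℂ} (hf : Per f) (x y : ℝ) (a b : ℤ) :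
    f (x + 2 * Real.pi * a, y + 2 * Real.pi * b) = f (x, y) := by
  have h1 : Function.Periodic (fun u => f (u, y + 2 * Real.pi * b)) (2 * Real.pi) :=
    fun u => (hf u _).1
  have h2 : Function.Periodic (fun u => f (x, u)) (2 * Real.pi) := fun u => (hf x u).2
  have e1 := h1.int_mul a x
  have e2 := h2.int_mul b y
  simp only [mul_comm (_ : ℝ) (2 * Real.pi)] at e1 e2
  rw [e1, e2]

/-- A function vanishing exactly on `ESetN N`, dominated by the distance to it. -/
def gapFun (N : ℕ) (t : ℝ) : ℝ :=
  ∏ k ∈ Finset.Icc (-(N : ℤ)) N, |Real.sin ((t - k) / 2)|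

lemma continuous_gapFun (N : ℕ) : Continuous (gapFun N) := by
  unfold gapFun
  fun_prop

lemma gapFun_nonneg (N : ℕ) (t : ℝ) : 0 ≤ gapFun N t :=
  Finset.prod_nonneg fun _ _ => abs_nonneg _

lemma gapFun_le_one (N : ℕ) (t : ℝ) : gapFun N t ≤ 1 :=
  Finset.prod_le_one (fun _ _ => abs_nonneg _) fun _ _ => Real.abs_sin_le_one _

lemma gapFun_add_two_pi (N : ℕ) (t : ℝ) : gapFun N (t + 2 * Real.pi) = gapFun N t := by
  refine Finset.prod_congr rfl fun k _ => ?_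
  rw [show (t + 2 * Real.pi - k) / 2 = (t - k) / 2 + Real.pi by ring, Real.sin_add_pi, abs_neg]

lemma gapFun_add_int_mul (N : ℕ) (t : ℝ) (m : ℤ) :
    gapFun N (t + 2 * Real.pi * m) = gapFun N t := by
  have h : Function.Periodic (gapFun N) (2 * Real.pi) := gapFun_add_two_pi N
  rw [mul_comm]
  exact h.int_mul m t

lemma gapFun_le_half_abs_sub {N : ℕ} {e : ℝ} (he : e ∈ ESetN N) (t : ℝ) :
    gapFun N t ≤ |t - e| / 2 := by
  obtain ⟨k, m, hk, rfl⟩ := he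
  have hk' : k ∈ Finset.Icc (-(N : ℤ)) N := Finset.mem_Icc.2 (abs_le.1 hk)
  have hper := gapFun_add_int_mul N (t - 2 * Real.pi * m) m
  rw [sub_add_cancel] at hper
  rw [hper, gapFun, ← Finset.mul_prod_erase _ _ hk']
  calc _ ≤ |Real.sin ((t - 2 * Real.pi * m - k) / 2)| * 1 := by
        gcongr
        exact Finset.prod_le_one (fun _ _ => abs_nonneg _) fun _ _ => Real.abs_sin_le_one _
    _ ≤ |(t - 2 * Real.pi * m - k) / 2| := by
        rw [mul_one]
        exact Real.abs_sin_le_abs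
    _ = _ := by
        rw [abs_div, abs_two]
        congr 2
        ring

lemma gapFun_pos {N : ℕ} {t : ℝ} (ht : t ∉ ESetN N) : 0 < gapFun N t := by
  refine Finset.prod_pos fun k hk => abs_pos.2 fun h => ht ?_
  obtain ⟨m, hm⟩ := Real.sin_eq_zero_iff.1 h
  exact ⟨k, m, abs_le.2 (Finset.mem_Icc.1 hk), by linarith⟩

lemma gapFun_eq_zero {N : ℕ} {e : ℝ} (he : e ∈ ESetN N) : gapFun N e = 0 :=
  le_antisymm (by simpa using gapFun_le_half_abs_sub he e) (gapFun_nonneg N e)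

/-- The average of `f (p.1, ·)` over `[p.2, p.2 + h p.2]`. -/
def verticalAverage (f : ℝ × ℝ → ℂ) (h : ℝ → ℝ) (p : ℝ × ℝ) : ℂ :=
  ∫ s in Set.Icc (0 : ℝ) 1, f (p.1, p.2 + s * h p.2)

lemma ae_add_mul_notMem_of_countable {S : Set ℝ} (hS : S.Countable) (t : ℝ) {c : ℝ} (hc : c ≠ 0) :
    ∀ᵐ s : ℝ, t + s * c ∉ S := by
  have hinj : Function.Injective fun s : ℝ => t + s * c := fun a b hab =>
    mul_right_cancel₀ hc (add_left_cancel hab)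
  simpa using (hS.preimage hinj).ae_notMem volume

lemma aestronglyMeasurable_vertical {f : ℝ × ℝ → ℂ}
    (hf : ∀ p : ℝ × ℝ, p.2 ∉ ESet → ContinuousAt f p) (x t c : ℝ) (μ : Measure ℝ)
    (hμ : μ ≪ volume) :
    AEStronglyMeasurable (fun s : ℝ => f (x, t + s * c)) μ := by
  refine AEStronglyMeasurable.mono_ac hμ ?_
  rcases eq_or_ne c 0 with rfl | hc
  · simpa using aestronglyMeasurable_const
  have hae := ae_add_mul_notMem_of_countable countable_ESet t hc
  have hmeas : MeasurableSet {s : ℝ | t + s * c ∉ ESet} :=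
    (countable_ESet.measurableSet.preimage (by fun_prop : Measurable fun s : ℝ => t + s * c)).compl
  rw [← Measure.restrict_eq_self_of_ae_mem hae]
  refine ContinuousOn.aestronglyMeasurable (fun s hs => ?_) hmeas
  have h1 : ContinuousAt (fun s : ℝ => (x, t + s * c)) s := by fun_prop
  exact (ContinuousAt.comp (f := fun s : ℝ => (x, t + s * c)) (hf _ hs) h1).continuousWithinAt

lemma tendsto_verticalAverage {f : ℝ × ℝ → ℂ} {C : ℝ} (hC : ∀ p, ‖f p‖ ≤ C)
    (hf : ∀ p : ℝ × ℝ, p.2 ∉ ESet → ContinuousAt f p) (h : ℝ → ℝ)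
    {l : Filter (ℝ × ℝ)} [l.IsCountablyGenerated] {F : ℝ → ℂ}
    (hF : ∀ᵐ s : ℝ, s ∈ Set.Icc (0 : ℝ) 1 →
      Tendsto (fun p : ℝ × ℝ => f (p.1, p.2 + s * h p.2)) l (𝓝 (F s))) :
    Tendsto (verticalAverage f h) l (𝓝 (∫ s in Set.Icc (0 : ℝ) 1, F s)) := by
  refine tendsto_integral_filter_of_dominated_convergence (fun _ => C) ?_ ?_ ?_ ?_
  · exact Eventually.of_forall fun p =>
      aestronglyMeasurable_vertical hf _ _ _ _ Measure.restrict_le_self.absolutelyContinuous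
  · exact Eventually.of_forall fun p => Eventually.of_forall fun s => hC _
  · exact integrable_const _
  · exact (ae_restrict_iff' measurableSet_Icc).2 hF

lemma norm_sub_verticalAverage_le {f : ℝ × ℝ → ℂ} {C : ℝ} (hC : ∀ p, ‖f p‖ ≤ C)
    (hf : ∀ p : ℝ × ℝ, p.2 ∉ ESet → ContinuousAt f p) (h : ℝ → ℝ) (p : ℝ × ℝ) (c : ℂ) {ε : ℝ}
    (hε : ∀ s ∈ Set.Icc (0 : ℝ) 1, ‖c - f (p.1, p.2 + s * h p.2)‖ ≤ ε) :
    ‖c - verticalAverage f h p‖ ≤ ε := by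
  have hint : IntegrableOn (fun s : ℝ => f (p.1, p.2 + s * h p.2)) (Set.Icc (0 : ℝ) 1) :=
    Integrable.of_bound (aestronglyMeasurable_vertical hf _ _ _ _
      Measure.restrict_le_self.absolutelyContinuous) C (Eventually.of_forall fun s => hC _)
  have hc : c = ∫ _ in Set.Icc (0 : ℝ) 1, c := by simp
  rw [hc, verticalAverage, ← integral_sub (integrable_const _) hint]
  simpa using norm_setIntegral_le_of_norm_le_const (μ := volume) (s := Set.Icc (0 : ℝ) 1)
    (by simp) hε

lemma verticalAverage_of_eq_zero (f : ℝ × ℝ → ℂ) {h : ℝ → ℝ} {p : ℝ × ℝ} (hp : h p.2 = 0) :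
    verticalAverage f h p = f p := by
  simp [verticalAverage, hp]

lemma per_verticalAverage {f : ℝ × ℝ → ℂ} (hf : Per f) {h : ℝ → ℝ}
    (hh : ∀ t, h (t + 2 * Real.pi) = h t) : Per (verticalAverage f h) := by
  intro x y
  constructor
  · simp only [verticalAverage, (hf _ _).1]
  · simp only [verticalAverage, hh, add_right_comm y (2 * Real.pi), (hf _ _).2]

lemma continuousAt_verticalAverage {f : ℝ × ℝ → ℂ} {C : ℝ} (hC : ∀ p, ‖f p‖ ≤ C)
    (hf : ∀ p : ℝ × ℝ, p.2 ∉ ESet → ContinuousAt f p) {h : ℝ → ℝ} (hh : Continuous h)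
    {p : ℝ × ℝ} (hp : h p.2 ≠ 0) : ContinuousAt (verticalAverage f h) p := by
  refine tendsto_verticalAverage hC hf h ?_
  filter_upwards [ae_add_mul_notMem_of_countable countable_ESet p.2 hp] with s hs _
  have h1 : ContinuousAt (fun q : ℝ × ℝ => (q.1, q.2 + s * h q.2)) p := by fun_prop
  exact ContinuousAt.comp (f := fun q : ℝ × ℝ => (q.1, q.2 + s * h q.2)) (hf _ hs) h1

lemma sidedLimits_verticalAverage {f : ℝ × ℝ → ℂ} {C : ℝ} (hC : ∀ p, ‖f p‖ ≤ C)
    (hf : ∀ p : ℝ × ℝ, p.2 ∉ ESet → ContinuousAt f p) {h : ℝ → ℝ} (hh : Continuous h)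
    (hh0 : ∀ t, 0 ≤ h t) {e : ℝ} (he : ∀ t, h t ≤ |t - e| / 2) {gp gm : ℝ → ℂ}
    (hs : SidedLimits f e gp gm) : SidedLimits (verticalAverage f h) e gp gm := by
  refine ⟨hs.1, hs.2.1, fun x => ?_⟩
  obtain ⟨hp, hm, hx⟩ := hs.2.2 x
  have hz : h e = 0 := le_antisymm (by simpa using he e) (hh0 e)
  have key : ∀ s : ℝ, Tendsto (fun q : ℝ × ℝ => (q.1, q.2 + s * h q.2)) (𝓝 (x, e)) (𝓝 (x, e)) := by
    intro s
    have h1 : Continuous (fun q : ℝ × ℝ => (q.1, q.2 + s * h q.2)) := by fun_prop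
    simpa [hz] using h1.tendsto (x, e)
  refine ⟨?_, ?_, ?_⟩
  · have := tendsto_verticalAverage (l := 𝓝[{p : ℝ × ℝ | e < p.2}] (x, e)) hC hf h
      (F := fun _ => gp x) (Eventually.of_forall fun s hs => hp.comp ?_)
    · simpa using this
    refine tendsto_nhdsWithin_iff.2 ⟨(key s).mono_left nhdsWithin_le_nhds, ?_⟩
    filter_upwards [self_mem_nhdsWithin] with q hq
    have := mul_nonneg hs.1 (hh0 q.2)
    replace hq : e < q.2 := hq
    change e < q.2 + s * h q.2
    linarith
  · have := tendsto_verticalAverage (l := 𝓝[{p : ℝ × ℝ | p.2 < e}] (x, e)) hC hf h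
      (F := fun _ => gm x) (Eventually.of_forall fun s hs => hm.comp ?_)
    · simpa using this
    refine tendsto_nhdsWithin_iff.2 ⟨(key s).mono_left nhdsWithin_le_nhds, ?_⟩
    filter_upwards [self_mem_nhdsWithin] with q hq
    replace hq : q.2 < e := hq
    change q.2 + s * h q.2 < e
    have h1 := mul_le_mul_of_nonneg_right hs.2 (hh0 q.2)
    have h2 := he q.2
    rw [abs_of_neg (by linarith)] at h2
    linarith
  · rw [verticalAverage_of_eq_zero f hz, hx]

lemma SidedLimits.unique {f : ℝ × ℝ → ℂ} {e : ℝ} {gp gm gp' gm' : ℝ → ℂ}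
    (h : SidedLimits f e gp gm) (h' : SidedLimits f e gp' gm') : gp = gp' ∧ gm = gm' := by
  refine ⟨funext fun x => (h.2.2 x).2.2.symm.trans (h'.2.2 x).2.2, funext fun x => ?_⟩
  have hne : (𝓝[{p : ℝ × ℝ | p.2 < e}] (x, e)).NeBot := by
    have : {p : ℝ × ℝ | p.2 < e} = Set.univ ×ˢ Set.Iio e := by ext; simp
    rw [this, nhdsWithin_prod_eq, nhdsWithin_univ]
    infer_instance
  exact tendsto_nhds_unique (h.2.2 x).2.1 (h'.2.2 x).2.1

lemma SidedLimits.translate {f : ℝ × ℝ → ℂ} (hf : Per f) {e : ℝ} {gp gm : ℝ → ℂ}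
    (h : SidedLimits f e gp gm) (m : ℤ) : SidedLimits f (e + 2 * Real.pi * m) gp gm := by
  have hcomp : f = f ∘ fun p : ℝ × ℝ => (p.1, p.2 - 2 * Real.pi * m) := by
    funext p
    have := hf.add_int_mul p.1 (p.2 - 2 * Real.pi * m) 0 m
    simpa using this
  have hcont : Continuous fun p : ℝ × ℝ => (p.1, p.2 - 2 * Real.pi * m) := by fun_prop
  refine ⟨h.1, h.2.1, fun x => ?_⟩
  obtain ⟨hp, hm, hx⟩ := h.2.2 x
  have ht := hcont.tendsto (x, e + 2 * Real.pi * m)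
  simp only [add_sub_cancel_right] at ht
  refine ⟨?_, ?_, ?_⟩
  · rw [hcomp]
    refine hp.comp (tendsto_nhdsWithin_iff.2 ⟨ht.mono_left nhdsWithin_le_nhds, ?_⟩)
    filter_upwards [self_mem_nhdsWithin] with q hq
    replace hq : e + 2 * Real.pi * m < q.2 := hq
    change e < q.2 - 2 * Real.pi * m
    linarith
  · rw [hcomp]
    refine hm.comp (tendsto_nhdsWithin_iff.2 ⟨ht.mono_left nhdsWithin_le_nhds, ?_⟩)
    filter_upwards [self_mem_nhdsWithin] with q hq
    replace hq : q.2 < e + 2 * Real.pi * m := hq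
    change q.2 - 2 * Real.pi * m < e
    linarith
  · rw [← hx]
    simpa using hf.add_int_mul x e 0 m

lemma SidedLimits.eventually_norm_sub_lt {f : ℝ × ℝ → ℂ} {e : ℝ} {gp gm : ℝ → ℂ}
    (h : SidedLimits f e gp gm) (x : ℝ) {η : ℝ} (hη : 0 < η) :
    ∀ᶠ q in 𝓝 (x, e), (e ≤ q.2 → ‖f q - gp x‖ < η) ∧ (q.2 < e → ‖f q - gm x‖ < η) := by
  obtain ⟨hp, hm, -⟩ := h.2.2 x
  have h1 := eventually_nhdsWithin_iff.1 (Metric.tendsto_nhds.1 hp η hη)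
  have h2 := eventually_nhdsWithin_iff.1 (Metric.tendsto_nhds.1 hm η hη)
  have h3 : Tendsto (fun q : ℝ × ℝ => gp q.1) (𝓝 (x, e)) (𝓝 (gp x)) :=
    (h.1.2.1.comp continuous_fst).tendsto (x, e)
  filter_upwards [h1, h2, Metric.tendsto_nhds.1 h3 η hη] with q q1 q2 q3
  simp only [dist_eq_norm] at q1 q2 q3
  refine ⟨fun hq => ?_, q2⟩
  rcases hq.lt_or_eq with hlt | heq
  · exact q1 hlt
  · have : f q = gp q.1 := by
      rw [← (h.2.2 q.1).2.2, heq]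
    rwa [this]

/-- If all jumps of `f` off `ESetN N` are small, then `f` oscillates little near every point along
vertical segments that do not jump across `ESetN N`. -/
lemma eventually_norm_sub_le {f : ℝ × ℝ → ℂ} {N : ℕ} {ε : ℝ} (hε : 0 < ε)
    (hf : ∀ p : ℝ × ℝ, p.2 ∉ ESet → ContinuousAt f p) {gp gm : ℝ → ℝ → ℂ}
    (hs : ∀ e ∈ ESet, SidedLimits f e (gp e) (gm e))
    (hjump : ∀ e ∈ ESet, e ∉ ESetN N → ∀ x, ‖gp e x - gm e x‖ ≤ ε / 4) (p : ℝ × ℝ) :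
    ∃ U : Set (ℝ × ℝ), IsOpen U ∧ p ∈ U ∧ ∀ x t t' : ℝ, (x, t) ∈ U → (x, t') ∈ U → t ≤ t' →
      (∀ e ∈ ESetN N, t < e → t' < e) → ‖f (x, t) - f (x, t')‖ ≤ ε := by
  have h4 : 0 < ε / 4 := by positivity
  by_cases hp : p.2 ∈ ESet
  · obtain ⟨U, hU, hUo, hpU⟩ := eventually_nhds_iff.1 ((hs _ hp).eventually_norm_sub_lt p.1 h4)
    refine ⟨U, hUo, hpU, fun x t t' ht ht' htt hcross => ?_⟩
    obtain ⟨a1, a2⟩ := hU _ ht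
    obtain ⟨b1, b2⟩ := hU _ ht'
    simp only at a1 a2 b1 b2
    rcases lt_or_ge t p.2 with h | h
    · rcases lt_or_ge t' p.2 with h' | h'
      · have := norm_sub_le_norm_sub_add_norm_sub (f (x, t)) (gm p.2 p.1) (f (x, t'))
        rw [norm_sub_rev (gm p.2 p.1)] at this
        linarith [a2 h, b2 h']
      · have hN : p.2 ∉ ESetN N := fun hN => h'.not_gt (hcross _ hN h)
        have t1 := norm_sub_le_norm_sub_add_norm_sub (f (x, t)) (gm p.2 p.1) (f (x, t'))
        have t2 := norm_sub_le_norm_sub_add_norm_sub (gm p.2 p.1) (gp p.2 p.1) (f (x, t'))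
        rw [norm_sub_rev (gm p.2 p.1) (gp p.2 p.1), norm_sub_rev (gp p.2 p.1) (f (x, t'))] at t2
        linarith [a2 h, b1 h', hjump _ hp hN p.1]
    · have := norm_sub_le_norm_sub_add_norm_sub (f (x, t)) (gp p.2 p.1) (f (x, t'))
      rw [norm_sub_rev (gp p.2 p.1)] at this
      linarith [a1 h, b1 (h.trans htt)]
  · obtain ⟨U, hU, hUo, hpU⟩ := eventually_nhds_iff.1 (Metric.tendsto_nhds.1 (hf p hp) _ h4)
    refine ⟨U, hUo, hpU, fun x t t' ht ht' _ _ => ?_⟩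
    have := dist_triangle_right (f (x, t)) (f (x, t')) (f p)
    rw [← dist_eq_norm]
    linarith [hU _ ht, hU _ ht']

lemma exists_add_int_mul_mem_Icc (t : ℝ) :
    ∃ m : ℤ, t + 2 * Real.pi * m ∈ Set.Icc 0 (2 * Real.pi) := by
  refine ⟨-toIcoDiv Real.two_pi_pos 0 t, ?_⟩
  have h := sub_toIcoDiv_zsmul_mem_Ico Real.two_pi_pos 0 t
  rw [zero_add, zsmul_eq_mul] at h
  convert Set.Ico_subset_Icc_self h using 1
  push_cast
  ring

lemma exists_uniform_norm_sub_le {f : ℝ × ℝ → ℂ} (hper : Per f) {N : ℕ} {ε : ℝ}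
    (hloc : ∀ p : ℝ × ℝ, ∃ U : Set (ℝ × ℝ), IsOpen U ∧ p ∈ U ∧ ∀ x t t' : ℝ, (x, t) ∈ U →
      (x, t') ∈ U → t ≤ t' → (∀ e ∈ ESetN N, t < e → t' < e) → ‖f (x, t) - f (x, t')‖ ≤ ε) :
    ∃ δ > 0, ∀ x t s : ℝ, 0 ≤ s → s < δ → (∀ e ∈ ESetN N, t < e → t + s < e) →
      ‖f (x, t) - f (x, t + s)‖ ≤ ε := by
  choose U hUo hpU hU using hloc
  obtain ⟨δ, hδ, hleb⟩ := lebesgue_number_lemma_of_metric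
    ((isCompact_Icc (a := (0 : ℝ)) (b := 2 * Real.pi)).prod
      (isCompact_Icc (a := (0 : ℝ)) (b := 2 * Real.pi)))
    hUo (fun p _ => Set.mem_iUnion.2 ⟨p, hpU p⟩)
  refine ⟨δ, hδ, fun x t s hs0 hs hcross => ?_⟩
  obtain ⟨a, ha⟩ := exists_add_int_mul_mem_Icc x
  obtain ⟨b, hb⟩ := exists_add_int_mul_mem_Icc t
  obtain ⟨i, hi⟩ := hleb (_, _) ⟨ha, hb⟩
  rw [← hper.add_int_mul x t a b, ← hper.add_int_mul x (t + s) a b]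
  refine hU i _ _ _ (hi (Metric.mem_ball_self hδ)) (hi ?_) (by linarith) fun e he hlt => ?_
  · rw [Metric.mem_ball, Prod.dist_eq, dist_self, Real.dist_eq]
    refine max_lt hδ ?_
    rw [show t + s + 2 * Real.pi * b - (t + 2 * Real.pi * b) = s by ring, abs_of_nonneg hs0]
    exact hs
  · have h1 : e - 2 * Real.pi * b ∈ ESetN N := by
      rw [← add_two_pi_mul_mem_ESetN b, sub_add_cancel]
      exact he
    linarith [hcross _ h1 (by linarith)]

lemma exists_jump_le {f : ℝ × ℝ → ℂ} (hper : Per f) {gp gm : ℝ → ℝ → ℂ}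
    (hs : ∀ e ∈ ESet, SidedLimits f e (gp e) (gm e))
    (hlim : Tendsto (fun k : ℤ => ⨆ x : ℝ, ‖gp (k : ℝ) x - gm (k : ℝ) x‖) cofinite (𝓝 0))
    {η : ℝ} (hη : 0 < η) :
    ∃ N : ℕ, ∀ e ∈ ESet, e ∉ ESetN N → ∀ x, ‖gp e x - gm e x‖ ≤ η := by
  have hfin : {k : ℤ | ¬ (⨆ x : ℝ, ‖gp (k : ℝ) x - gm (k : ℝ) x‖) < η}.Finite :=
    eventually_cofinite.1 (hlim.eventually_lt_const hη)
  obtain ⟨N, hN⟩ := (hfin.image Int.natAbs).bddAbove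
  refine ⟨N, ?_⟩
  rintro _ ⟨k, m, rfl⟩ hnot x
  have hk : (k : ℝ) ∈ ESet := ⟨k, 0, by simp⟩
  obtain ⟨e1, e2⟩ := (hs _ ⟨k, m, rfl⟩).unique ((hs _ hk).translate hper m)
  rw [e1, e2]
  have hlt : (⨆ x : ℝ, ‖gp (k : ℝ) x - gm (k : ℝ) x‖) < η := by
    by_contra hge
    have := hN (Set.mem_image_of_mem Int.natAbs hge)
    exact hnot ⟨k, m, by rw [Int.abs_eq_natAbs]; exact_mod_cast this, rfl⟩
  obtain ⟨⟨A, hA⟩, -⟩ := (hs _ hk).1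
  obtain ⟨⟨B, hB⟩, -⟩ := (hs _ hk).2.1
  have hbdd : BddAbove (Set.range fun x : ℝ => ‖gp (k : ℝ) x - gm (k : ℝ) x‖) := by
    refine ⟨A + B, ?_⟩
    rintro _ ⟨y, rfl⟩
    exact (norm_sub_le _ _).trans (add_le_add (hA y) (hB y))
  exact (le_ciSup hbdd x).trans hlt.le

/-- For every `f ∈ 𝒜` and every `ε > 0` there are `N ∈ ℕ` and `g ∈ 𝒞_N` with
`sup |f − g| ≤ ε`: the union `⋃_N 𝒞_N` is dense in `𝒜` in the sup norm. -/
theorem stmt_2 :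
    ∀ f : ℝ × ℝ → ℂ, MemA f → ∀ ε : ℝ, 0 < ε →
      ∃ (N : ℕ) (g : ℝ × ℝ → ℂ), MemC N g ∧ ∀ p : ℝ × ℝ, ‖f p - g p‖ ≤ ε := by
  rintro f ⟨⟨C, hC⟩, hper, hf, gp, gm, hs, hlim⟩ ε hε
  obtain ⟨N, hjump⟩ := exists_jump_le hper hs hlim (show 0 < ε / 4 by positivity)
  obtain ⟨δ, hδ, hunif⟩ :=
    exists_uniform_norm_sub_le hper (eventually_norm_sub_le hε hf hs hjump)
  set c := min (δ / 2) 1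
  have hc0 : 0 < c := lt_min (by positivity) one_pos
  have hcδ : c ≤ δ / 2 := min_le_left _ _
  set h : ℝ → ℝ := fun t => c * gapFun N t with hh
  have hcont : Continuous h := continuous_const.mul (continuous_gapFun N)
  have hnonneg : ∀ t, 0 ≤ h t := fun t => mul_nonneg hc0.le (gapFun_nonneg N t)
  have hle : ∀ e ∈ ESetN N, ∀ t, h t ≤ |t - e| / 2 := fun e he t =>
    (mul_le_of_le_one_left (gapFun_nonneg N t) (min_le_right _ _)).trans
      (gapFun_le_half_abs_sub he t)
  have hltδ : ∀ t, h t < δ := fun t =>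
    (mul_le_of_le_one_right hc0.le (gapFun_le_one N t)).trans_lt (by linarith)
  refine ⟨N, verticalAverage f h, ⟨⟨C, fun p => ?_⟩, ?_, fun p hp => ?_, fun e he => ?_⟩,
    fun p => ?_⟩
  · simpa using norm_sub_verticalAverage_le hC hf h p 0 (fun s _ => by simpa using hC _)
  · exact per_verticalAverage hper fun t => by simp only [hh, gapFun_add_two_pi]
  · exact continuousAt_verticalAverage hC hf hcont (mul_pos hc0 (gapFun_pos hp)).ne'
  · exact ⟨gp e, gm e, sidedLimits_verticalAverage hC hf hcont hnonneg (hle e he)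
      (hs e (ESetN_subset_ESet N he))⟩
  · refine norm_sub_verticalAverage_le hC hf h p (f p) fun s hs => ?_
    have hsh : s * h p.2 ≤ h p.2 := mul_le_of_le_one_left (hnonneg _) hs.2
    refine hunif p.1 p.2 (s * h p.2) (mul_nonneg hs.1 (hnonneg _)) (hsh.trans_lt (hltδ _))
      fun e he hlt => ?_
    have h1 := hle e he p.2
    rw [abs_of_neg (by linarith)] at h1
    linarith
end
end
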